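/- arXiv:2601.13726 — 2 statements merged into one kernel-verified Lean document; each statement's English description precedes it below -/
import Mathlib

section
/- There is an absolute constant C > 0 such that for every L > 1 and every n = (n₁,n₂) ∈ ℤ_{≥0}², the Lebesgue measure of the set {α ∈ [0,1)² : min(s₁(a(n)Λ_α), s₁*(a(n)Λ_α)) ≤ L^{-1}} is at most C·(L^{-3} + L^{-2}·e^{-min(n₁,n₂)}). -/
open MeasureTheory
open scoped ENNReal

noncomputable section

/-- The unit box `[0,1)²`. -/
def box2 : Set (ℝ × ℝ) := Set.Ico (0:ℝ) 1 ×ˢ Set.Ico (0:ℝ) 1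

/-- The lattice vector `(qα₁+p₁, qα₂+p₂, q)` of `Λ_α` attached to `(p₁,p₂,q) ∈ ℤ³`. -/
def latVec (α : ℝ × ℝ) (v : ℤ × ℤ × ℤ) : ℝ × ℝ × ℝ :=
  ((v.2.2 : ℝ) * α.1 + (v.1 : ℝ), (v.2.2 : ℝ) * α.2 + (v.2.1 : ℝ), (v.2.2 : ℝ))

/-- The diagonal map `a(t)(x₁,x₂,y) = (e^{t₁}x₁, e^{t₂}x₂, e^{-t₁-t₂}y)`. -/
def aMap (t : ℝ × ℝ) (x : ℝ × ℝ × ℝ) : ℝ × ℝ × ℝ :=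
  (Real.exp t.1 * x.1, Real.exp t.2 * x.2.1, Real.exp (-t.1 - t.2) * x.2.2)

/-- The sup-norm on `ℝ³`. -/
def supNorm3 (x : ℝ × ℝ × ℝ) : ℝ := max |x.1| (max |x.2.1| |x.2.2|)

/-- The sup-norm of the wedge `u ∧ v` of two vectors of `ℝ³`. -/
def wedgeNorm (u v : ℝ × ℝ × ℝ) : ℝ :=
  max |u.1 * v.2.1 - u.2.1 * v.1|
    (max |u.1 * v.2.2 - u.2.2 * v.1| |u.2.1 * v.2.2 - u.2.2 * v.2.1|)

/-- The points `x ∈ [0,1)` at which `k x + c` is within `δ` of an integer. -/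
def nearIntSet (k : ℤ) (c δ : ℝ) : Set ℝ :=
  {x | x ∈ Set.Ico (0:ℝ) 1 ∧ ∃ m : ℤ, |(k : ℝ) * x + c + m| ≤ δ}

theorem volume_nearIntSet_le {k : ℤ} (hk : k ≠ 0) (c : ℝ) {δ : ℝ} (h0 : 0 ≤ δ) (h1 : δ ≤ 1) :
    volume (nearIntSet k c δ) ≤ ENNReal.ofReal (14 * δ) := by
  have hk1 : (1 : ℤ) ≤ |k| := Int.one_le_abs hk
  have hkR : (1 : ℝ) ≤ |(k : ℝ)| := by exact_mod_cast hk1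
  have hk0 : 0 < |(k : ℝ)| := by linarith
  have hsub : nearIntSet k c δ ⊆
      ⋃ m ∈ Finset.Icc (-⌊c⌋ - |k| - 2) (-⌊c⌋ + |k| + 2),
        Metric.closedBall (-(c + m) / (k : ℝ)) (δ / |(k : ℝ)|) := by
    rintro x ⟨⟨hx0, hx1⟩, m, hm⟩
    have hkx : |(k : ℝ) * x| ≤ |(k : ℝ)| := by
      rw [abs_mul, abs_of_nonneg hx0]
      exact mul_le_of_le_one_right (abs_nonneg _) hx1.le
    simp only [Set.mem_iUnion, Finset.mem_Icc, exists_prop]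
    refine ⟨m, ⟨?_, ?_⟩, ?_⟩
    · have := Int.lt_floor_add_one c
      have : ((-⌊c⌋ - |k| - 2 : ℤ) : ℝ) ≤ m := by
        push_cast
        linarith [abs_le.mp hm, abs_le.mp hkx]
      exact_mod_cast this
    · have := Int.floor_le c
      have : (m : ℝ) ≤ ((-⌊c⌋ + |k| + 2 : ℤ) : ℝ) := by
        push_cast
        linarith [abs_le.mp hm, abs_le.mp hkx]
      exact_mod_cast this
    · have hk' : (k : ℝ) ≠ 0 := by exact_mod_cast hk
      rw [Metric.mem_closedBall, Real.dist_eq, le_div_iff₀ hk0, ← abs_mul,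
        show (x - -(c + m) / k) * k = k * x + c + m by field_simp; ring]
      exact hm
  calc volume (nearIntSet k c δ)
      ≤ ∑ m ∈ Finset.Icc (-⌊c⌋ - |k| - 2) (-⌊c⌋ + |k| + 2),
          volume (Metric.closedBall (-(c + m) / (k : ℝ)) (δ / |(k : ℝ)|)) :=
        (measure_mono hsub).trans (measure_biUnion_finset_le _ _)
    _ = ENNReal.ofReal ((2 * |(k : ℝ)| + 5) * (2 * (δ / |(k : ℝ)|))) := by
        have hcard : ((Finset.Icc (-⌊c⌋ - |k| - 2) (-⌊c⌋ + |k| + 2)).card : ℝ)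
            = 2 * |(k : ℝ)| + 5 := by
          have h : ((Finset.Icc (-⌊c⌋ - |k| - 2) (-⌊c⌋ + |k| + 2)).card : ℤ) = 2 * |k| + 5 := by
            rw [Int.card_Icc]
            omega
          exact_mod_cast h
        simp only [Real.volume_closedBall, Finset.sum_const]
        rw [← ENNReal.ofReal_nsmul, nsmul_eq_mul, hcard]
    _ ≤ ENNReal.ofReal (14 * δ) := by
        apply ENNReal.ofReal_le_ofReal
        rw [← mul_div_assoc, ← mul_div_assoc, div_le_iff₀ hk0]
        nlinarith

/-- The points `α` of the unit box at which `A α₁ + B α₂` is within `δ` of an integer. -/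
def nearLineSet (A B : ℤ) (δ : ℝ) : Set (ℝ × ℝ) :=
  {α | α ∈ box2 ∧ ∃ m : ℤ, |(A : ℝ) * α.1 + B * α.2 + m| ≤ δ}

theorem measurableSet_nearLineSet (A B : ℤ) (δ : ℝ) : MeasurableSet (nearLineSet A B δ) := by
  have h : nearLineSet A B δ =
      box2 ∩ ⋃ m : ℤ, {α : ℝ × ℝ | |(A : ℝ) * α.1 + B * α.2 + m| ≤ δ} := by
    ext α
    simp [nearLineSet]
  rw [h]
  refine (measurableSet_Ico.prod measurableSet_Ico).inter (MeasurableSet.iUnion fun m => ?_)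
  exact (isClosed_le (by fun_prop) continuous_const).measurableSet

theorem volume_nearLineSet_le_of_right_ne_zero (A : ℤ) {B : ℤ} (hB : B ≠ 0) {δ : ℝ}
    (h0 : 0 ≤ δ) (h1 : δ ≤ 1) :
    volume (nearLineSet A B δ) ≤ ENNReal.ofReal (14 * δ) := by
  rw [Measure.volume_eq_prod, Measure.prod_apply (measurableSet_nearLineSet A B δ)]
  calc ∫⁻ x, volume (Prod.mk x ⁻¹' nearLineSet A B δ)
      ≤ ∫⁻ x, (Set.Ico (0:ℝ) 1).indicator (fun _ => ENNReal.ofReal (14 * δ)) x := by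
        refine lintegral_mono fun x => ?_
        by_cases hx : x ∈ Set.Ico (0:ℝ) 1
        · rw [Set.indicator_of_mem hx]
          refine (measure_mono ?_).trans (volume_nearIntSet_le hB (A * x) h0 h1)
          rintro y ⟨⟨-, hy⟩, m, hm⟩
          exact ⟨hy, m, by rwa [add_comm ((B : ℝ) * y)]⟩
        · have he : Prod.mk x ⁻¹' nearLineSet A B δ = ∅ :=
            Set.eq_empty_of_forall_notMem fun y hy => hx hy.1.1
          simp [he]
    _ = ENNReal.ofReal (14 * δ) := by
        rw [lintegral_indicator_const measurableSet_Ico]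
        simp

theorem volume_nearLineSet_comm (A B : ℤ) (δ : ℝ) :
    volume (nearLineSet A B δ) = volume (nearLineSet B A δ) := by
  have h : nearLineSet A B δ = Prod.swap ⁻¹' nearLineSet B A δ := by
    ext ⟨x, y⟩
    simp only [nearLineSet, box2, Set.mem_ofPred_eq, Set.mem_preimage, Prod.swap_prod_mk,
      Set.mem_prod, add_comm ((A : ℝ) * x), and_comm (a := x ∈ Set.Ico (0:ℝ) 1)]
  rw [h]
  exact (Measure.measurePreserving_swap (μ := (volume : Measure ℝ))
    (ν := (volume : Measure ℝ))).measure_preimage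
      (measurableSet_nearLineSet B A δ).nullMeasurableSet

theorem volume_nearLineSet_le {w : ℤ × ℤ} (hw : w ≠ 0) {δ : ℝ} (h0 : 0 ≤ δ) (h1 : δ ≤ 1) :
    volume (nearLineSet w.1 w.2 δ) ≤ ENNReal.ofReal (14 * δ) := by
  by_cases hB : w.2 = 0
  · rw [volume_nearLineSet_comm]
    exact volume_nearLineSet_le_of_right_ne_zero _ (fun hA => hw (Prod.ext hA hB)) h0 h1
  · exact volume_nearLineSet_le_of_right_ne_zero _ hB h0 h1

theorem Int.mem_Icc_floor_of_abs_le {m : ℤ} {x : ℝ} (h : |(m : ℝ)| ≤ x) :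
    m ∈ Finset.Icc (-(⌊x⌋₊ : ℤ)) ⌊x⌋₊ := by
  have h' : m.natAbs ≤ ⌊x⌋₊ := Nat.le_floor (by simpa [Nat.cast_natAbs] using h)
  rw [Finset.mem_Icc]
  omega

theorem Int.card_Icc_neg_natCast (N : ℕ) : (Finset.Icc (-(N : ℤ)) N).card = 2 * N + 1 := by
  rw [Int.card_Icc]
  omega

section

variable {ε T₁ T₂ : ℝ}

/-- The `α` whose lattice, stretched by `(T₁, T₂, (T₁T₂)⁻¹)`, has a nonzero vector of sup-norm
at most `ε`. -/
def shortVectorSet (ε T₁ T₂ : ℝ) : Set (ℝ × ℝ) :=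
  {α | α ∈ box2 ∧ ∃ p₁ p₂ q : ℤ, (p₁ ≠ 0 ∨ p₂ ≠ 0 ∨ q ≠ 0) ∧ |(q : ℝ) * α.1 + p₁| ≤ ε / T₁ ∧
    |(q : ℝ) * α.2 + p₂| ≤ ε / T₂ ∧ |(q : ℝ)| ≤ ε * (T₁ * T₂)}

/-- The `α` whose dual lattice, stretched accordingly, has a nonzero vector of sup-norm
at most `ε`. -/
def shortDualVectorSet (ε T₁ T₂ : ℝ) : Set (ℝ × ℝ) :=
  {α | α ∈ box2 ∧ ∃ A B m : ℤ, (A ≠ 0 ∨ B ≠ 0 ∨ m ≠ 0) ∧ |(A : ℝ)| ≤ ε * T₁ ∧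
    |(B : ℝ)| ≤ ε * T₂ ∧ |(A : ℝ) * α.1 + B * α.2 + m| ≤ ε / (T₁ * T₂)}

theorem volume_shortVectorSet_le (h0 : 0 < ε) (h1 : ε < 1) (hT₁ : 1 ≤ T₁) (hT₂ : 1 ≤ T₂) :
    volume (shortVectorSet ε T₁ T₂) ≤ ENNReal.ofReal (392 * ε ^ 3) := by
  have hd₁ : ε / T₁ < 1 := (div_lt_one (by linarith)).2 (by linarith)
  have hd₂ : ε / T₂ < 1 := (div_lt_one (by linarith)).2 (by linarith)
  have hp₁ : 0 < ε / T₁ := by positivity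
  have hp₂ : 0 < ε / T₂ := by positivity
  set N := ⌊ε * (T₁ * T₂)⌋₊
  set F := (Finset.Icc (-(N : ℤ)) N).erase 0 with hF
  have hsub : shortVectorSet ε T₁ T₂ ⊆
      ⋃ q ∈ F, nearIntSet q 0 (ε / T₁) ×ˢ nearIntSet q 0 (ε / T₂) := by
    rintro ⟨x, y⟩ ⟨⟨hx, hy⟩, p₁, p₂, q, hne, hqx, hqy, hq⟩
    have hq0 : q ≠ 0 := by
      rintro rfl
      simp only [Int.cast_zero, zero_mul, zero_add] at hqx hqy
      have e₁ : p₁ = 0 := Int.abs_lt_one_iff.mp (by exact_mod_cast hqx.trans_lt hd₁)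
      have e₂ : p₂ = 0 := Int.abs_lt_one_iff.mp (by exact_mod_cast hqy.trans_lt hd₂)
      simp [e₁, e₂] at hne
    simp only [Set.mem_iUnion, exists_prop]
    exact ⟨q, Finset.mem_erase.2 ⟨hq0, Int.mem_Icc_floor_of_abs_le hq⟩,
      ⟨hx, p₁, by simpa using hqx⟩, ⟨hy, p₂, by simpa using hqy⟩⟩
  have hcard : F.card = 2 * N := by
    rw [hF, Finset.card_erase_of_mem (by simp), Int.card_Icc_neg_natCast]
    rfl
  calc volume (shortVectorSet ε T₁ T₂)
      ≤ ∑ q ∈ F, volume (nearIntSet q 0 (ε / T₁) ×ˢ nearIntSet q 0 (ε / T₂)) :=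
        (measure_mono hsub).trans (measure_biUnion_finset_le _ _)
    _ ≤ ∑ q ∈ F, ENNReal.ofReal (14 * (ε / T₁) * (14 * (ε / T₂))) := by
        refine Finset.sum_le_sum fun q hq => ?_
        have hq0 := (Finset.mem_erase.1 hq).1
        rw [Measure.volume_eq_prod, Measure.prod_prod, ENNReal.ofReal_mul (by positivity)]
        exact mul_le_mul' (volume_nearIntSet_le hq0 0 hp₁.le hd₁.le)
          (volume_nearIntSet_le hq0 0 hp₂.le hd₂.le)
    _ = ENNReal.ofReal (2 * N * (14 * (ε / T₁) * (14 * (ε / T₂)))) := by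
        rw [Finset.sum_const, ← ENNReal.ofReal_nsmul, nsmul_eq_mul, hcard]
        push_cast
        rfl
    _ ≤ ENNReal.ofReal (392 * ε ^ 3) := by
        apply ENNReal.ofReal_le_ofReal
        have hNle : (N : ℝ) ≤ ε * (T₁ * T₂) := Nat.floor_le (by positivity)
        calc 2 * N * (14 * (ε / T₁) * (14 * (ε / T₂)))
            ≤ 2 * (ε * (T₁ * T₂)) * (14 * (ε / T₁) * (14 * (ε / T₂))) := by gcongr
          _ = 392 * ε ^ 3 := by
            field_simp
            norm_num

theorem volume_shortDualVectorSet_le (h0 : 0 < ε) (h1 : ε < 1) (hT₁ : 1 ≤ T₁) (hT₂ : 1 ≤ T₂) :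
    volume (shortDualVectorSet ε T₁ T₂) ≤
      ENNReal.ofReal (56 * ε ^ 3 + 28 * ε ^ 2 * (T₁⁻¹ + T₂⁻¹)) := by
  have hTT : 1 ≤ T₁ * T₂ := one_le_mul_of_one_le_of_one_le hT₁ hT₂
  have hd : ε / (T₁ * T₂) < 1 := (div_lt_one (by linarith)).2 (by linarith)
  have hp : 0 < ε / (T₁ * T₂) := by positivity
  set a := ⌊ε * T₁⌋₊
  set b := ⌊ε * T₂⌋₊
  set F := (Finset.Icc (-(a : ℤ)) a ×ˢ Finset.Icc (-(b : ℤ)) b).erase 0 with hF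
  have hsub : shortDualVectorSet ε T₁ T₂ ⊆
      ⋃ w ∈ F, nearLineSet w.1 w.2 (ε / (T₁ * T₂)) := by
    rintro α ⟨hα, A, B, m, hne, hA, hB, hm⟩
    have hw : (A, B) ≠ (0 : ℤ × ℤ) := by
      intro h
      obtain ⟨rfl, rfl⟩ := Prod.mk.inj h
      simp only [Int.cast_zero, zero_mul, zero_add] at hm
      have e : m = 0 := Int.abs_lt_one_iff.mp (by exact_mod_cast hm.trans_lt hd)
      simp [e] at hne
    simp only [Set.mem_iUnion, exists_prop]
    exact ⟨(A, B), Finset.mem_erase.2 ⟨hw, Finset.mem_product.2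
      ⟨Int.mem_Icc_floor_of_abs_le hA, Int.mem_Icc_floor_of_abs_le hB⟩⟩, hα, m, hm⟩
  have hcard : F.card = 4 * a * b + 2 * a + 2 * b := by
    rw [hF, Finset.card_erase_of_mem (by simp [Finset.mem_product]), Finset.card_product,
      Int.card_Icc_neg_natCast, Int.card_Icc_neg_natCast]
    refine Nat.sub_eq_of_eq_add ?_
    ring
  calc volume (shortDualVectorSet ε T₁ T₂)
      ≤ ∑ w ∈ F, volume (nearLineSet w.1 w.2 (ε / (T₁ * T₂))) :=
        (measure_mono hsub).trans (measure_biUnion_finset_le _ _)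
    _ ≤ ∑ w ∈ F, ENNReal.ofReal (14 * (ε / (T₁ * T₂))) :=
        Finset.sum_le_sum fun w hw =>
          volume_nearLineSet_le (Finset.mem_erase.1 hw).1 hp.le hd.le
    _ = ENNReal.ofReal ((4 * a * b + 2 * a + 2 * b) * (14 * (ε / (T₁ * T₂)))) := by
        rw [Finset.sum_const, ← ENNReal.ofReal_nsmul, nsmul_eq_mul, hcard]
        push_cast
        rfl
    _ ≤ ENNReal.ofReal (56 * ε ^ 3 + 28 * ε ^ 2 * (T₁⁻¹ + T₂⁻¹)) := by
        apply ENNReal.ofReal_le_ofReal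
        have hale : (a : ℝ) ≤ ε * T₁ := Nat.floor_le (by positivity)
        have hble : (b : ℝ) ≤ ε * T₂ := Nat.floor_le (by positivity)
        calc (4 * a * b + 2 * a + 2 * b) * (14 * (ε / (T₁ * T₂)))
            ≤ (4 * (ε * T₁) * (ε * T₂) + 2 * (ε * T₁) + 2 * (ε * T₂)) *
                (14 * (ε / (T₁ * T₂))) := by gcongr
          _ = 56 * ε ^ 3 + 28 * ε ^ 2 * (T₁⁻¹ + T₂⁻¹) := by
            field_simp
            ring

end

theorem mem_shortVectorSet {α : ℝ × ℝ} (hα : α ∈ box2) {ε : ℝ} {t : ℝ × ℝ} {v : ℤ × ℤ × ℤ}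
    (hv : v ≠ 0) (h : supNorm3 (aMap t (latVec α v)) ≤ ε) :
    α ∈ shortVectorSet ε (Real.exp t.1) (Real.exp t.2) := by
  obtain ⟨p₁, p₂, q⟩ := v
  simp only [supNorm3, aMap, latVec, max_le_iff, abs_mul, Real.abs_exp] at h
  obtain ⟨h₁, h₂, h₃⟩ := h
  refine ⟨hα, p₁, p₂, q, ?_, ?_, ?_, ?_⟩
  · by_contra! hz
    exact hv (by simp [hz])
  · rwa [le_div_iff₀' (Real.exp_pos _)]
  · rwa [le_div_iff₀' (Real.exp_pos _)]
  · rwa [show -t.1 - t.2 = -(t.1 + t.2) by ring, Real.exp_neg, Real.exp_add,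
      inv_mul_le_iff₀' (by positivity)] at h₃

theorem wedgeNorm_aMap_latVec (α t : ℝ × ℝ) (v v' : ℤ × ℤ × ℤ) :
    wedgeNorm (aMap t (latVec α v)) (aMap t (latVec α v')) =
      max (Real.exp t.1 * Real.exp t.2 *
          |((v.2.2 * v'.2.1 - v.2.1 * v'.2.2 : ℤ) : ℝ) * α.1 +
            ((v.1 * v'.2.2 - v.2.2 * v'.1 : ℤ) : ℝ) * α.2 +
            ((v.1 * v'.2.1 - v.2.1 * v'.1 : ℤ) : ℝ)|)
        (max ((Real.exp t.2)⁻¹ * |((v.1 * v'.2.2 - v.2.2 * v'.1 : ℤ) : ℝ)|)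
          ((Real.exp t.1)⁻¹ * |((v.2.2 * v'.2.1 - v.2.1 * v'.2.2 : ℤ) : ℝ)|)) := by
  have hexp : Real.exp (-t.1 - t.2) = (Real.exp t.1)⁻¹ * (Real.exp t.2)⁻¹ := by
    rw [sub_eq_add_neg, Real.exp_add, Real.exp_neg, Real.exp_neg]
  have e₁ := Real.exp_pos t.1
  have e₂ := Real.exp_pos t.2
  simp only [wedgeNorm, aMap, latVec, hexp]
  congr 1
  · rw [← abs_of_pos (mul_pos e₁ e₂), ← abs_mul]
    push_cast
    congr 1
    ring
  congr 1
  · rw [← abs_of_pos (inv_pos.2 e₂), ← abs_mul, abs_of_pos (inv_pos.2 e₂)]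
    push_cast
    congr 1
    field_simp
    ring
  · rw [← abs_of_pos (inv_pos.2 e₁), ← abs_mul, abs_of_pos (inv_pos.2 e₁), ← abs_neg]
    push_cast
    congr 1
    field_simp
    ring

theorem mem_shortDualVectorSet {α : ℝ × ℝ} (hα : α ∈ box2) {ε : ℝ} {t : ℝ × ℝ}
    {v v' : ℤ × ℤ × ℤ}
    (hne : wedgeNorm (aMap t (latVec α v)) (aMap t (latVec α v')) ≠ 0)
    (h : wedgeNorm (aMap t (latVec α v)) (aMap t (latVec α v')) ≤ ε) :
    α ∈ shortDualVectorSet ε (Real.exp t.1) (Real.exp t.2) := by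
  rw [wedgeNorm_aMap_latVec] at hne h
  simp only [max_le_iff] at h
  obtain ⟨h₁, h₂, h₃⟩ := h
  refine ⟨hα, v.2.2 * v'.2.1 - v.2.1 * v'.2.2, v.1 * v'.2.2 - v.2.2 * v'.1,
    v.1 * v'.2.1 - v.2.1 * v'.1, ?_, ?_, ?_, ?_⟩
  · by_contra! hz
    exact hne (by rw [hz.1, hz.2.1, hz.2.2]; simp)
  · rwa [inv_mul_le_iff₀' (Real.exp_pos _)] at h₃
  · rwa [inv_mul_le_iff₀' (Real.exp_pos _)] at h₂
  · rwa [le_div_iff₀' (by positivity)]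

theorem stmt11 :
    ∃ C > 0, ∀ (L : ℝ), 1 < L → ∀ n : ℕ × ℕ,
      volume {α : ℝ × ℝ | α ∈ box2 ∧
          ((∃ v : ℤ × ℤ × ℤ, v ≠ 0 ∧
              supNorm3 (aMap ((n.1 : ℝ), (n.2 : ℝ)) (latVec α v)) ≤ L⁻¹) ∨
            (∃ v v' : ℤ × ℤ × ℤ,
              wedgeNorm (aMap ((n.1 : ℝ), (n.2 : ℝ)) (latVec α v))
                  (aMap ((n.1 : ℝ), (n.2 : ℝ)) (latVec α v')) ≠ 0 ∧
              wedgeNorm (aMap ((n.1 : ℝ), (n.2 : ℝ)) (latVec α v))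
                  (aMap ((n.1 : ℝ), (n.2 : ℝ)) (latVec α v')) ≤ L⁻¹))} ≤
        ENNReal.ofReal (C * (L⁻¹ ^ 3 + L⁻¹ ^ 2 * Real.exp (-((min n.1 n.2 : ℕ) : ℝ)))) := by
  refine ⟨448, by norm_num, fun L hL n => ?_⟩
  have h0 : 0 < L⁻¹ := by positivity
  have h1 : L⁻¹ < 1 := inv_lt_one_of_one_lt₀ hL
  have hT₁ : 1 ≤ Real.exp (n.1 : ℝ) := Real.one_le_exp (Nat.cast_nonneg _)
  have hT₂ : 1 ≤ Real.exp (n.2 : ℝ) := Real.one_le_exp (Nat.cast_nonneg _)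
  refine (measure_mono (t := shortVectorSet L⁻¹ (Real.exp n.1) (Real.exp n.2) ∪
    shortDualVectorSet L⁻¹ (Real.exp n.1) (Real.exp n.2)) ?_).trans ?_
  · rintro α ⟨hα, ⟨v, hv, h⟩ | ⟨v, v', hne, h⟩⟩
    · exact Or.inl (mem_shortVectorSet hα hv h)
    · exact Or.inr (mem_shortDualVectorSet hα hne h)
  refine (measure_union_le _ _).trans ((add_le_add (volume_shortVectorSet_le h0 h1 hT₁ hT₂)
    (volume_shortDualVectorSet_le h0 h1 hT₁ hT₂)).trans ?_)
  rw [← ENNReal.ofReal_add (by positivity) (by positivity)]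
  apply ENNReal.ofReal_le_ofReal
  have hm₁ : (Real.exp (n.1 : ℝ))⁻¹ ≤ Real.exp (-((min n.1 n.2 : ℕ) : ℝ)) := by
    rw [← Real.exp_neg, Real.exp_le_exp, neg_le_neg_iff]
    exact_mod_cast min_le_left _ _
  have hm₂ : (Real.exp (n.2 : ℝ))⁻¹ ≤ Real.exp (-((min n.1 n.2 : ℕ) : ℝ)) := by
    rw [← Real.exp_neg, Real.exp_le_exp, neg_le_neg_iff]
    exact_mod_cast min_le_right _ _
  have hsq : 0 < L⁻¹ ^ 2 := by positivity
  have := mul_le_mul_of_nonneg_left hm₁ hsq.le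
  have := mul_le_mul_of_nonneg_left hm₂ hsq.le
  have : 0 ≤ L⁻¹ ^ 2 * Real.exp (-((min n.1 n.2 : ℕ) : ℝ)) := by positivity
  linarith

end
end

section
/- There is an absolute constant C > 0 with the following property. Let s ∈ ℝ, β, η > 0, and let m be a nonnegative integer with m > ln η. Let B be the set of x = (x₁,x₂,x₃) ∈ [−1/2,1/2]³ for which there exists v = (v₁,v₂,v₃) ∈ ℤ³∖{0} satisfying |v₁ + x₁v₃| ≤ η·β^{1/2}·e^{m/2−s}, |v₂ + x₂v₁ + x₃v₃| ≤ η·e^{−m}, and |v₃| ≤ η·β^{1/2}·e^{m/2+s}. Then for every ϱ ∈ [0,1/2]: Vol(B) ≤ C·(η³·β + η^{3−2ϱ}·β^{1−ϱ}·e^{−ϱm−2(1−ϱ)s}), with C independent of ϱ, s, β, η, m. -/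
open MeasureTheory
open scoped ENNReal

noncomputable section

/-- The cube `[-1/2,1/2]³`. -/
def cube3 : Set (ℝ × ℝ × ℝ) :=
  Set.Icc (-(1:ℝ)/2) (1/2) ×ˢ Set.Icc (-(1:ℝ)/2) (1/2) ×ˢ Set.Icc (-(1:ℝ)/2) (1/2)

/-- The points `x` of `[-1/2,1/2]` for which `t + x * k` lies within `R` of the integer `-n`. -/
def nearInt (k : ℤ) (t R : ℝ) (n : ℤ) : Set ℝ :=
  {x | x ∈ Set.Icc (-(1:ℝ)/2) (1/2) ∧ |(n : ℝ) + t + x * k| ≤ R}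

/-- The nonzero integers of absolute value at most `R`. -/
def nonzeroUpTo (R : ℝ) : Finset ℤ := (Finset.Icc (-⌊R⌋) ⌊R⌋).erase 0

lemma mem_nonzeroUpTo {R : ℝ} {k : ℤ} : k ∈ nonzeroUpTo R ↔ k ≠ 0 ∧ |(k : ℝ)| ≤ R := by
  have h : |(k : ℝ)| ≤ R ↔ |k| ≤ ⌊R⌋ := by
    rw [Int.le_floor]; push_cast; rfl
  simp only [nonzeroUpTo, Finset.mem_erase, Finset.mem_Icc, h, abs_le]

lemma card_nonzeroUpTo_le {R : ℝ} (hR : 0 ≤ R) : ((nonzeroUpTo R).card : ℝ) ≤ 2 * R := by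
  have h0 : 0 ≤ ⌊R⌋ := Int.floor_nonneg.2 hR
  have hc : ((nonzeroUpTo R).card : ℤ) = 2 * ⌊R⌋ := by
    rw [nonzeroUpTo, Finset.card_erase_of_mem (by simp [h0]), Int.card_Icc]
    omega
  have hc' : ((nonzeroUpTo R).card : ℝ) = 2 * ⌊R⌋ := by exact_mod_cast hc
  rw [hc']
  linarith [Int.floor_le R]

lemma card_nonzeroUpTo_le_rpow {R p : ℝ} (hR : 0 ≤ R) (hp : 1 ≤ p) :
    ((nonzeroUpTo R).card : ℝ) ≤ 2 * R ^ p := by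
  rcases lt_or_ge R 1 with h | h
  · have he : nonzeroUpTo R = ∅ := by
      refine Finset.eq_empty_of_forall_notMem fun k hk => ?_
      obtain ⟨hk0, hk⟩ := mem_nonzeroUpTo.1 hk
      have : (1 : ℝ) ≤ |(k : ℝ)| := by exact_mod_cast Int.one_le_abs hk0
      linarith
    rw [he, Finset.card_empty, Nat.cast_zero]
    positivity
  · have := Real.self_le_rpow_of_one_le h hp
    linarith [card_nonzeroUpTo_le hR]

lemma card_Icc_ceil_floor_le {a b : ℝ} (h : 0 ≤ b - a + 1) :
    ((Finset.Icc ⌈a⌉ ⌊b⌋).card : ℝ) ≤ b - a + 1 := by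
  rw [Int.card_Icc, ← Int.cast_natCast, Int.toNat_eq_max]
  push_cast
  refine max_le ?_ h
  linarith [Int.floor_le b, Int.le_ceil a]

lemma volume_nearInt_le {k : ℤ} (hk : k ≠ 0) (t R : ℝ) (n : ℤ) :
    volume (nearInt k t R n) ≤ ENNReal.ofReal (2 * R / |(k : ℝ)|) := by
  have hk' : (k : ℝ) ≠ 0 := by exact_mod_cast hk
  have hpos : 0 < |(k : ℝ)| := abs_pos.2 hk'
  have hsub : nearInt k t R n ⊆ Metric.closedBall (-((n : ℝ) + t) / k) (R / |(k : ℝ)|) := by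
    rintro x ⟨-, hx⟩
    rw [Metric.mem_closedBall, Real.dist_eq, le_div_iff₀ hpos, ← abs_mul]
    have h : (x - -((n : ℝ) + t) / k) * k = (n : ℝ) + t + x * k := by
      field_simp
      ring
    rwa [h]
  refine (measure_mono hsub).trans_eq ?_
  rw [Real.volume_closedBall, mul_div_assoc]

lemma volume_nearInt_le_one (k : ℤ) (t R : ℝ) (n : ℤ) :
    volume (nearInt k t R n) ≤ ENNReal.ofReal 1 := by
  refine (measure_mono (fun x hx => hx.1)).trans_eq (Real.volume_Icc.trans ?_)
  norm_num

lemma tsum_volume_nearInt_le {k : ℤ} (hk : k ≠ 0) (t : ℝ) {R : ℝ} (hR : 0 ≤ R) :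
    ∑' n : ℤ, volume (nearInt k t R n) ≤ ENNReal.ofReal (8 * R) := by
  have hk1 : (1 : ℝ) ≤ |(k : ℝ)| := by exact_mod_cast Int.one_le_abs hk
  set K := |(k : ℝ)| with hK
  set F : Finset ℤ := Finset.Icc ⌈-(R + K / 2) - t⌉ ⌊R + K / 2 - t⌋ with hF
  have hcard : (F.card : ℝ) ≤ 2 * R + K + 1 := by
    have := card_Icc_ceil_floor_le (a := -(R + K / 2) - t) (b := R + K / 2 - t) (by linarith)
    linarith
  have hzero : ∀ n ∉ F, volume (nearInt k t R n) = 0 := by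
    intro n hn
    suffices nearInt k t R n = ∅ by rw [this, measure_empty]
    refine Set.eq_empty_of_forall_notMem fun x hx => hn ?_
    obtain ⟨hxI, hxR⟩ := hx
    have hx2 : |x| ≤ 1 / 2 := abs_le.2 ⟨by linarith [hxI.1], hxI.2⟩
    have hxk : |x * k| ≤ K / 2 := by
      rw [abs_mul]
      nlinarith
    rw [abs_le] at hxR hxk
    rw [hF, Finset.mem_Icc, Int.ceil_le, Int.le_floor]
    constructor <;> linarith
  have key : ∀ M : ℝ, 0 ≤ M → (∀ n, volume (nearInt k t R n) ≤ ENNReal.ofReal M) →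
      (2 * R + K + 1) * M ≤ 8 * R →
      ∑' n : ℤ, volume (nearInt k t R n) ≤ ENNReal.ofReal (8 * R) := by
    intro M hM hvol hle
    rw [tsum_eq_sum hzero]
    refine (Finset.sum_le_card_nsmul _ _ _ fun n _ => hvol n).trans ?_
    rw [← ENNReal.ofReal_nsmul, nsmul_eq_mul]
    exact ENNReal.ofReal_le_ofReal ((mul_le_mul_of_nonneg_right hcard hM).trans hle)
  rcases le_total R K with h | h
  · refine key (2 * R / K) (by positivity) (volume_nearInt_le hk t R) ?_
    rw [mul_div_assoc', div_le_iff₀ (by linarith)]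
    nlinarith
  · exact key 1 zero_le_one (volume_nearInt_le_one k t R) (by linarith)

lemma volume_iUnion_nearInt_le {k : ℤ} (hk : k ≠ 0) (t : ℝ) {R : ℝ} (hR : 0 ≤ R) :
    volume (⋃ n, nearInt k t R n) ≤ ENNReal.ofReal (8 * R) :=
  (measure_iUnion_le _).trans (tsum_volume_nearInt_le hk t hR)

/-- The points `(y, z)` of `[-1/2,1/2]²` for which `y * j + z * k` lies within `R` of `ℤ`. -/
def nearIntPlane (j k : ℤ) (R : ℝ) : Set (ℝ × ℝ) :=
  {y | y.1 ∈ Set.Icc (-(1:ℝ)/2) (1/2) ∧ y.2 ∈ ⋃ n, nearInt k (y.1 * j) R n}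

lemma measurableSet_nearIntPlane (j k : ℤ) (R : ℝ) : MeasurableSet (nearIntPlane j k R) := by
  simp only [nearIntPlane, nearInt, Set.mem_iUnion, Set.mem_ofPred_eq, Set.mem_Icc]
  measurability

lemma volume_nearIntPlane_le (j : ℤ) {k : ℤ} (hk : k ≠ 0) {R : ℝ} (hR : 0 ≤ R) :
    volume (nearIntPlane j k R) ≤ ENNReal.ofReal (8 * R) := by
  rw [Measure.volume_eq_prod, Measure.prod_apply (measurableSet_nearIntPlane j k R)]
  calc ∫⁻ x, volume (Prod.mk x ⁻¹' nearIntPlane j k R)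
      ≤ ∫⁻ x, (Set.Icc (-(1:ℝ)/2) (1/2)).indicator (fun _ => ENNReal.ofReal (8 * R)) x := by
        refine lintegral_mono fun x => ?_
        by_cases hx : x ∈ Set.Icc (-(1:ℝ)/2) (1/2)
        · rw [Set.indicator_of_mem hx]
          exact (measure_mono fun y hy => hy.2).trans (volume_iUnion_nearInt_le hk (x * j) hR)
        · have : Prod.mk x ⁻¹' nearIntPlane j k R = ∅ :=
            Set.eq_empty_of_forall_notMem fun y hy => hx hy.1
          simp [this]
    _ = ENNReal.ofReal (8 * R) := by
        rw [lintegral_indicator_const measurableSet_Icc, Real.volume_Icc]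
        norm_num

/-- The part of the exceptional set coming from vectors with vanishing last coordinate. -/
lemma volume_iUnion_slab_le {a b p : ℝ} (ha : 0 ≤ a) (hb : 0 ≤ b) (hp : 1 ≤ p) :
    volume (⋃ j ∈ nonzeroUpTo a, Set.Icc (-(1:ℝ)/2) (1/2) ×ˢ
      ((⋃ n, nearInt j 0 b n) ×ˢ Set.Icc (-(1:ℝ)/2) (1/2))) ≤
      ENNReal.ofReal (16 * (a ^ p * b)) := by
  refine (measure_biUnion_finset_le _ _).trans ?_
  have h : ∀ j ∈ nonzeroUpTo a, volume (Set.Icc (-(1:ℝ)/2) (1/2) ×ˢ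
      ((⋃ n, nearInt j 0 b n) ×ˢ Set.Icc (-(1:ℝ)/2) (1/2))) ≤ ENNReal.ofReal (8 * b) := by
    intro j hj
    rw [Measure.volume_eq_prod, Measure.prod_prod, Measure.volume_eq_prod, Measure.prod_prod,
      Real.volume_Icc]
    have h1 : ENNReal.ofReal ((1:ℝ) / 2 - -1 / 2) = 1 := by norm_num
    rw [h1, one_mul, mul_one]
    exact volume_iUnion_nearInt_le (mem_nonzeroUpTo.1 hj).1 0 hb
  refine (Finset.sum_le_card_nsmul _ _ _ h).trans ?_
  rw [← ENNReal.ofReal_nsmul, nsmul_eq_mul]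
  refine ENNReal.ofReal_le_ofReal ?_
  nlinarith [mul_le_mul_of_nonneg_right (card_nonzeroUpTo_le_rpow ha hp) hb]

/-- The part of the exceptional set coming from vectors with nonzero last coordinate. -/
lemma volume_iUnion_nearIntPlane_le {a b c : ℝ} (ha : 0 ≤ a) (hb : 0 ≤ b) (hc : 0 ≤ c) :
    volume (⋃ k ∈ nonzeroUpTo c, ⋃ j : ℤ, nearInt k 0 a j ×ˢ nearIntPlane j k b) ≤
      ENNReal.ofReal (128 * (a * b * c)) := by
  refine (measure_biUnion_finset_le _ _).trans ?_
  have h : ∀ k ∈ nonzeroUpTo c, volume (⋃ j : ℤ, nearInt k 0 a j ×ˢ nearIntPlane j k b) ≤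
      ENNReal.ofReal (8 * a * (8 * b)) := by
    intro k hk
    have hk0 := (mem_nonzeroUpTo.1 hk).1
    calc volume (⋃ j : ℤ, nearInt k 0 a j ×ˢ nearIntPlane j k b)
        ≤ ∑' j : ℤ, volume (nearInt k 0 a j ×ˢ nearIntPlane j k b) := measure_iUnion_le _
      _ ≤ ∑' j : ℤ, volume (nearInt k 0 a j) * ENNReal.ofReal (8 * b) := by
          refine ENNReal.tsum_le_tsum fun j => ?_
          rw [Measure.volume_eq_prod, Measure.prod_prod]
          gcongr
          exact volume_nearIntPlane_le j hk0 hb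
      _ ≤ ENNReal.ofReal (8 * a * (8 * b)) := by
          rw [ENNReal.tsum_mul_right, ENNReal.ofReal_mul (p := 8 * a) (by positivity)]
          gcongr
          exact tsum_volume_nearInt_le hk0 0 ha
  refine (Finset.sum_le_card_nsmul _ _ _ h).trans ?_
  rw [← ENNReal.ofReal_nsmul, nsmul_eq_mul]
  refine ENNReal.ofReal_le_ofReal ?_
  nlinarith [mul_le_mul_of_nonneg_right (card_nonzeroUpTo_le hc) (mul_nonneg ha hb)]

lemma exceptional_subset {a b c : ℝ} (hb : b < 1) :
    {x : ℝ × ℝ × ℝ | x ∈ cube3 ∧ ∃ v : ℤ × ℤ × ℤ, v ≠ 0 ∧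
      |(v.1 : ℝ) + x.1 * (v.2.2 : ℝ)| ≤ a ∧
      |(v.2.1 : ℝ) + x.2.1 * (v.1 : ℝ) + x.2.2 * (v.2.2 : ℝ)| ≤ b ∧ |(v.2.2 : ℝ)| ≤ c} ⊆
    (⋃ k ∈ nonzeroUpTo c, ⋃ j : ℤ, nearInt k 0 a j ×ˢ nearIntPlane j k b) ∪
    (⋃ j ∈ nonzeroUpTo a, Set.Icc (-(1:ℝ)/2) (1/2) ×ˢ
      ((⋃ n, nearInt j 0 b n) ×ˢ Set.Icc (-(1:ℝ)/2) (1/2))) := by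
  rintro ⟨x, y, z⟩ ⟨⟨hx, hy, hz⟩, ⟨j, n, k⟩, hv, h1, h2, h3⟩
  dsimp only at hx hy hz h1 h2 h3
  by_cases hk : k = 0
  · right
    subst hk
    simp only [Int.cast_zero, mul_zero, add_zero] at h1 h2
    have hj : j ≠ 0 := by
      rintro rfl
      simp only [Int.cast_zero, mul_zero, add_zero] at h2
      have hn : |n| < 1 := by exact_mod_cast h2.trans_lt hb
      rw [Int.abs_lt_one_iff] at hn
      exact hv (by rw [hn]; rfl)
    exact Set.mem_biUnion (mem_nonzeroUpTo.2 ⟨hj, h1⟩)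
      ⟨hx, Set.mem_iUnion.2 ⟨n, hy, by simpa using h2⟩, hz⟩
  · left
    exact Set.mem_biUnion (mem_nonzeroUpTo.2 ⟨hk, h3⟩) (Set.mem_iUnion.2
      ⟨j, ⟨hx, by simpa using h1⟩, hy, Set.mem_iUnion.2 ⟨n, hz, h2⟩⟩)

lemma radii_mul_eq {s β η m : ℝ} (hβ : 0 < β) :
    η * √β * Real.exp (m / 2 - s) * (η * Real.exp (-m)) * (η * √β * Real.exp (m / 2 + s)) =
      η ^ 3 * β := by
  have he : Real.exp (m / 2 - s) * Real.exp (-m) * Real.exp (m / 2 + s) = 1 := by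
    rw [← Real.exp_add, ← Real.exp_add, ← Real.exp_zero]
    ring_nf
  calc _ = η ^ 3 * (√β * √β) *
        (Real.exp (m / 2 - s) * Real.exp (-m) * Real.exp (m / 2 + s)) := by ring
    _ = η ^ 3 * β := by rw [he, Real.mul_self_sqrt hβ.le, mul_one]

lemma radius_rpow_mul_eq {s β η m ϱ : ℝ} (hβ : 0 < β) (hη : 0 < η) :
    (η * √β * Real.exp (m / 2 - s)) ^ (2 - 2 * ϱ) * (η * Real.exp (-m)) =
      η ^ (3 - 2 * ϱ) * β ^ (1 - ϱ) * Real.exp (-ϱ * m - 2 * (1 - ϱ) * s) := by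
  have h1 : η ^ (3 - 2 * ϱ) = η ^ (2 - 2 * ϱ) * η := by
    rw [← Real.rpow_add_one hη.ne']
    ring_nf
  have h2 : √β ^ (2 - 2 * ϱ) = β ^ (1 - ϱ) := by
    rw [Real.sqrt_eq_rpow, ← Real.rpow_mul hβ.le]
    ring_nf
  have h3 : Real.exp (-ϱ * m - 2 * (1 - ϱ) * s) =
      Real.exp (m / 2 - s) ^ (2 - 2 * ϱ) * Real.exp (-m) := by
    rw [← Real.exp_mul, ← Real.exp_add]
    ring_nf
  rw [Real.mul_rpow (by positivity) (by positivity), Real.mul_rpow hη.le (by positivity), h1, h2,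
    h3]
  ring

theorem stmt13 :
    ∃ C > 0, ∀ (s β η : ℝ) (m : ℕ), 0 < β → 0 < η → Real.log η < (m : ℝ) →
      ∀ ϱ ∈ Set.Icc (0:ℝ) (1/2),
        volume {x : ℝ × ℝ × ℝ | x ∈ cube3 ∧ ∃ v : ℤ × ℤ × ℤ, v ≠ 0 ∧
            |(v.1 : ℝ) + x.1 * (v.2.2 : ℝ)| ≤
              η * Real.sqrt β * Real.exp ((m : ℝ) / 2 - s) ∧
            |(v.2.1 : ℝ) + x.2.1 * (v.1 : ℝ) + x.2.2 * (v.2.2 : ℝ)| ≤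
              η * Real.exp (-(m : ℝ)) ∧
            |(v.2.2 : ℝ)| ≤ η * Real.sqrt β * Real.exp ((m : ℝ) / 2 + s)} ≤
          ENNReal.ofReal (C * (η ^ 3 * β +
            η ^ ((3:ℝ) - 2 * ϱ) * β ^ ((1:ℝ) - ϱ) *
              Real.exp (-ϱ * (m : ℝ) - 2 * (1 - ϱ) * s))) := by
  refine ⟨128, by norm_num, fun s β η m hβ hη hm ϱ hϱ => ?_⟩
  have hb : η * Real.exp (-(m : ℝ)) < 1 := by
    rw [Real.exp_neg, ← div_eq_mul_inv, div_lt_one (Real.exp_pos _)]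
    exact (Real.log_lt_iff_lt_exp hη).1 hm
  refine (measure_mono (exceptional_subset hb)).trans ((measure_union_le _ _).trans ?_)
  refine (add_le_add (volume_iUnion_nearIntPlane_le (by positivity) (by positivity)
    (by positivity)) (volume_iUnion_slab_le (p := 2 - 2 * ϱ) (by positivity) (by positivity)
    (by linarith [hϱ.2]))).trans ?_
  rw [radii_mul_eq hβ, radius_rpow_mul_eq hβ hη,
    ← ENNReal.ofReal_add (by positivity) (by positivity)]
  refine ENNReal.ofReal_le_ofReal ?_
  have : 0 ≤ η ^ ((3:ℝ) - 2 * ϱ) * β ^ ((1:ℝ) - ϱ) *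
      Real.exp (-ϱ * (m : ℝ) - 2 * (1 - ϱ) * s) := by positivity
  linarith

end
end
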